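/- arXiv:2301.07789 — 4 statements merged into one kernel-verified Lean document; each statement's English description precedes it below -/
import Mathlib

section
/- Let σ, s, c, β > 0 and 1/2 < λ ≤ 1. Define D(p) = 1 − Q(√(p/σ²)) and the prospect-theory subjective utility with fixed reference point 0, U_f(p) = s^λ · D(p) − β · (c·p)^λ, for p > 0. Then there exists a unique p_f > 0 such that U_f'(p_f) = 0, equivalently D'(p_f) · p_f^(1−λ) = β·λ·c^λ / s^λ; moreover U_f'(p) > 0 for all 0 < p < p_f and U_f'(p) < 0 for all p > p_f, so p_f is the unique global maximizer of U_f on (0, ∞). -/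
/-- The derivative of a tail integral `t ↦ ∫ u in Ioi t, f u` is `-f t`. -/
theorem hasDerivAt_integral_Ioi {f : ℝ → ℝ} (hf : Continuous f)
    (hi : MeasureTheory.Integrable f) (t : ℝ) :
    HasDerivAt (fun t => ∫ u in Set.Ioi t, f u) (-f t) t := by
  have h : (fun t => ∫ u in Set.Ioi t, f u)
      = fun t => (∫ u in Set.Ioi (0 : ℝ), f u) - ∫ u in (0 : ℝ)..t, f u := by
    funext t
    rw [← intervalIntegral.integral_interval_add_Ioi (a := 0) (b := t) hi.integrableOn
      hi.integrableOn]
    ring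
  rw [h]
  exact (hf.integral_hasStrictDerivAt 0 t).hasDerivAt.const_sub _

theorem integrable_exp_neg_sq_div_two :
    MeasureTheory.Integrable fun u : ℝ => Real.exp (-(u ^ 2) / 2) := by
  refine (integrable_exp_neg_mul_sq (b := 1 / 2) (by norm_num)).congr
    (Filter.Eventually.of_forall fun u => ?_)
  simp only
  congr 1
  ring

theorem strictAntiOn_exp_neg_mul_rpow_neg {a m : ℝ} (ha : 0 < a) (hm : 0 < m) :
    StrictAntiOn (fun p : ℝ => Real.exp (-(a * p)) * p ^ (-m)) (Set.Ioi 0) := by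
  intro x hx y _ hxy
  have h₁ : Real.exp (-(a * y)) < Real.exp (-(a * x)) := by
    rw [Real.exp_lt_exp]
    nlinarith
  have h₂ : y ^ (-m) < x ^ (-m) := Real.rpow_lt_rpow_of_neg hx hxy (by linarith)
  have h₃ : 0 < y ^ (-m) := Real.rpow_pos_of_pos (lt_trans hx hxy) _
  exact mul_lt_mul h₁ h₂.le h₃ (Real.exp_pos _).le

theorem exists_exp_neg_mul_rpow_neg_eq {a m T : ℝ} (ha : 0 < a) (hm : 0 < m) (hT : 0 < T) :
    ∃ p : ℝ, 0 < p ∧ Real.exp (-(a * p)) * p ^ (-m) = T := by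
  have hcont : ContinuousOn (fun p : ℝ => Real.exp (-(a * p)) * p ^ (-m)) (Set.Ioi 0) :=
    (by fun_prop : Continuous fun p : ℝ => Real.exp (-(a * p))).continuousOn.mul
      (continuousOn_id.rpow_const fun x hx => Or.inl (ne_of_gt hx))
  have hzero : Filter.Tendsto (fun p : ℝ => Real.exp (-(a * p)) * p ^ (-m))
      (nhdsWithin 0 (Set.Ioi 0)) Filter.atTop := by
    have he : Filter.Tendsto (fun p : ℝ => Real.exp (-(a * p)))
        (nhdsWithin 0 (Set.Ioi 0)) (nhds 1) := by
      have : Continuous fun p : ℝ => Real.exp (-(a * p)) := by fun_prop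
      simpa using (this.tendsto 0).mono_left nhdsWithin_le_nhds
    exact he.pos_mul_atTop one_pos (tendsto_rpow_neg_nhdsGT_zero (by linarith))
  have htop : Filter.Tendsto (fun p : ℝ => Real.exp (-(a * p)) * p ^ (-m))
      Filter.atTop (nhds 0) := by
    have he : Filter.Tendsto (fun p : ℝ => Real.exp (-(a * p))) Filter.atTop (nhds 0) :=
      Real.tendsto_exp_neg_atTop_nhds_zero.comp (Filter.tendsto_id.const_mul_atTop ha)
    simpa using he.mul (tendsto_rpow_neg_atTop hm)
  obtain ⟨x, hx, hx₀⟩ :=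
    ((hzero.eventually_ge_atTop T).and self_mem_nhdsWithin).exists
  obtain ⟨y, hy, hy₀⟩ :=
    ((htop.eventually_le_const hT).and (Filter.eventually_gt_atTop 0)).exists
  obtain ⟨p, hp, h⟩ := isPreconnected_Ioi.intermediate_value (Set.mem_Ioi.2 hy₀) hx₀ hcont
    ⟨hy, hx⟩
  exact ⟨p, hp, h⟩

/-- For `σ, s, c, β > 0` and `1/2 < λ ≤ 1`, the prospect-theory subjective
utility with fixed reference point `0`, `U_f(p) = s^λ·D(p) − β·(c·p)^λ` with
`D(p) = 1 − Q(√(p/σ²))`, has a unique stationary point `p_f > 0`, characterized by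
`D'(p_f)·p_f^(1−λ) = β·λ·c^λ/s^λ`; moreover `U_f' > 0` on `(0, p_f)` and `U_f' < 0` on
`(p_f, ∞)`, so `p_f` is the unique global maximizer of `U_f` on `(0, ∞)`. -/
theorem prospect_fixed_reference_unique_maximizer
    (σ s c β lam : ℝ) (hσ : 0 < σ) (hs : 0 < s) (hc : 0 < c) (hβ : 0 < β)
    (hlam₁ : 1 / 2 < lam) (hlam₂ : lam ≤ 1)
    (Q D Uf : ℝ → ℝ)
    (hQ : ∀ t, Q t = (Real.sqrt (2 * Real.pi))⁻¹ * ∫ u in Set.Ioi t, Real.exp (-(u ^ 2) / 2))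
    (hD : ∀ p, D p = 1 - Q (Real.sqrt (p / σ ^ 2)))
    (hUf : ∀ p, Uf p = s ^ lam * D p - β * (c * p) ^ lam) :
    ∃ pf : ℝ, 0 < pf ∧ deriv Uf pf = 0
      ∧ deriv D pf * pf ^ (1 - lam) = β * lam * c ^ lam / s ^ lam
      ∧ (∀ p : ℝ, 0 < p → p < pf → 0 < deriv Uf p)
      ∧ (∀ p : ℝ, pf < p → deriv Uf p < 0)
      ∧ (∀ p : ℝ, 0 < p → p ≠ pf → Uf p < Uf pf)
      ∧ (∀ q : ℝ, 0 < q → deriv Uf q = 0 → q = pf) := by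
  have hs' : 0 < s ^ lam := Real.rpow_pos_of_pos hs _
  have hc' : 0 < c ^ lam := Real.rpow_pos_of_pos hc _
  set K : ℝ := (Real.sqrt (2 * Real.pi))⁻¹ / (2 * σ) with hK
  have hK₀ : 0 < K := by positivity
  set T : ℝ := β * lam * c ^ lam / s ^ lam with hT
  have hT₀ : 0 < T := by
    have : 0 < lam := by linarith
    positivity
  set a : ℝ := 1 / (2 * σ ^ 2) with ha
  have ha₀ : 0 < a := by positivity
  set m : ℝ := lam - 1 / 2 with hm
  have hm₀ : 0 < m := by linarith
  have hDd : ∀ p, 0 < p →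
      HasDerivAt D (K * (Real.exp (-(a * p)) * p ^ (-m)) * p ^ (lam - 1)) p := by
    intro p hp
    have hsq := ((hasDerivAt_id' p).div_const (σ ^ 2)).sqrt (div_pos hp (pow_pos hσ 2)).ne'
    have hQd := (hasDerivAt_integral_Ioi (by fun_prop) integrable_exp_neg_sq_div_two
      (Real.sqrt (p / σ ^ 2))).const_mul (Real.sqrt (2 * Real.pi))⁻¹
    rw [← funext hQ] at hQd
    rw [funext hD]
    refine ((hQd.comp p hsq).const_sub 1).congr_deriv ?_
    have hpow : p ^ (-m) * p ^ (lam - 1) = (Real.sqrt p)⁻¹ := by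
      rw [← Real.rpow_add hp, Real.sqrt_eq_rpow, ← Real.rpow_neg hp.le]
      congr 1
      rw [hm]
      ring
    rw [mul_assoc, mul_assoc, mul_assoc (Real.exp _), hpow, Real.sq_sqrt (by positivity), Real.sqrt_div hp.le,
      Real.sqrt_sq hσ.le, show -(p / σ ^ 2) / 2 = -(a * p) by rw [ha]; field_simp, hK]
    have := Real.sqrt_pos.2 hp
    field_simp
  have hUd : ∀ p, 0 < p → HasDerivAt Uf
      (s ^ lam * p ^ (lam - 1) * (K * (Real.exp (-(a * p)) * p ^ (-m)) - T)) p := by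
    intro p hp
    have h := (((hasDerivAt_id' p).const_mul c).rpow_const (p := lam)
      (Or.inl (mul_pos hc hp).ne')).const_mul β
    rw [funext hUf]
    refine (((hDd p hp).const_mul (s ^ lam)).sub h).congr_deriv ?_
    rw [Real.mul_rpow hc.le hp.le, hT, Real.rpow_sub_one hc.ne' lam]
    field_simp
  obtain ⟨pf, hpf, hroot⟩ := exists_exp_neg_mul_rpow_neg_eq ha₀ hm₀ (div_pos hT₀ hK₀)
  have hKT : K * (T / K) = T := by field_simp
  have hanti := strictAntiOn_exp_neg_mul_rpow_neg ha₀ hm₀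
  have hfac : ∀ p : ℝ, 0 < p → 0 < s ^ lam * p ^ (lam - 1) := fun p hp =>
    mul_pos hs' (Real.rpow_pos_of_pos hp _)
  have hpos : ∀ p : ℝ, 0 < p → p < pf → 0 < deriv Uf p := by
    intro p hp hlt
    rw [(hUd p hp).deriv]
    refine mul_pos (hfac p hp) (sub_pos.2 ?_)
    calc T = K * (T / K) := hKT.symm
      _ < _ := mul_lt_mul_of_pos_left (hroot ▸ hanti hp hpf hlt) hK₀
  have hneg : ∀ p : ℝ, pf < p → deriv Uf p < 0 := by
    intro p hlt
    have hp := hpf.trans hlt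
    rw [(hUd p hp).deriv]
    refine mul_neg_of_pos_of_neg (hfac p hp) (sub_neg.2 ?_)
    calc _ < K * (T / K) := mul_lt_mul_of_pos_left (hroot ▸ hanti hpf hp hlt) hK₀
      _ = T := hKT
  have hcont : ∀ p, 0 < p → ContinuousAt Uf p := fun p hp => (hUd p hp).continuousAt
  refine ⟨pf, hpf, ?_, ?_, hpos, hneg, ?_, ?_⟩
  · rw [(hUd pf hpf).deriv, hroot, hKT, sub_self, mul_zero]
  · rw [(hDd pf hpf).deriv, hroot, hKT, mul_assoc, ← Real.rpow_add hpf]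
    simp
  · intro p hp hne
    rcases lt_or_gt_of_ne hne with hlt | hgt
    · refine strictMonoOn_of_deriv_pos (convex_Icc p pf)
        (fun x hx => (hcont x (hp.trans_le hx.1)).continuousWithinAt) (fun x hx => ?_)
        (Set.left_mem_Icc.2 hlt.le) (Set.right_mem_Icc.2 hlt.le) hlt
      rw [interior_Icc] at hx
      exact hpos x (hp.trans hx.1) hx.2
    · refine strictAntiOn_of_deriv_neg (convex_Icc pf p)
        (fun x hx => (hcont x (hpf.trans_le hx.1)).continuousWithinAt) (fun x hx => ?_)
        (Set.left_mem_Icc.2 hgt.le) (Set.right_mem_Icc.2 hgt.le) hgt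
      rw [interior_Icc] at hx
      exact hneg x hx.1
  · intro q hq hq₀
    rcases lt_trichotomy q pf with hlt | heq | hgt
    · exact absurd hq₀ (hpos q hq hlt).ne'
    · exact heq
    · exact absurd hq₀ (hneg q hgt).ne
end

section
/- Let σ, s, c > 0 and 1/2 < λ ≤ 1. For β > 0 let p_f(β) denote the unique positive solution of D'(p) · p^(1−λ) = β·λ·c^λ / s^λ, where D(p) = 1 − Q(√(p/σ²)), i.e., the unique maximizer of the subjective utility U_f(p) = s^λ·D(p) − β·(c·p)^λ over (0, ∞). Then p_f is strictly decreasing in β: if 0 < β₁ < β₂ then p_f(β₁) > p_f(β₂). -/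
theorem hasDerivAt_integral_Ioi_of_continuous {f : ℝ → ℝ} (hf : Continuous f)
    (hi : MeasureTheory.Integrable f) (t : ℝ) :
    HasDerivAt (fun x => ∫ u in Set.Ioi x, f u) (-f t) t := by
  have h : (fun x => ∫ u in Set.Ioi x, f u) =
      fun x => (∫ u in Set.Ioi 0, f u) - ∫ u in (0 : ℝ)..x, f u := by
    funext x
    rw [← intervalIntegral.integral_interval_add_Ioi (a := 0) (b := x) hi.integrableOn
      hi.integrableOn]
    ring
  rw [h]
  exact (hf.integral_hasStrictDerivAt 0 t).hasDerivAt.const_sub _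

/-- The derivative of the detection probability `1 - Q (√(p / σ²))` at `p > 0`. -/
theorem hasDerivAt_detection {σ : ℝ} (hσ : 0 < σ) {Q D : ℝ → ℝ}
    (hQ : ∀ t, Q t = (Real.sqrt (2 * Real.pi))⁻¹ * ∫ u in Set.Ioi t, Real.exp (-(u ^ 2) / 2))
    (hD : ∀ p, D p = 1 - Q (Real.sqrt (p / σ ^ 2))) {p : ℝ} (hp : 0 < p) :
    HasDerivAt D ((2 * σ * Real.sqrt (2 * Real.pi))⁻¹ *
      (Real.exp (-p / (2 * σ ^ 2)) * p ^ (-(1 / 2) : ℝ))) p := by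
  have hpos : 0 < p / σ ^ 2 := by positivity
  have hsqrt : HasDerivAt (fun x => Real.sqrt (x / σ ^ 2))
      (1 / σ ^ 2 / (2 * Real.sqrt (p / σ ^ 2))) p :=
    ((hasDerivAt_id p).div_const (σ ^ 2)).sqrt hpos.ne'
  have hint := hasDerivAt_integral_Ioi_of_continuous
    (f := fun u : ℝ => Real.exp (-(u ^ 2) / 2)) (by fun_prop)
    integrable_exp_neg_sq_div_two (Real.sqrt (p / σ ^ 2))
  have h := ((hint.comp p hsqrt).const_mul (Real.sqrt (2 * Real.pi))⁻¹).const_sub 1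
  have hDeq : D = fun x => 1 - (Real.sqrt (2 * Real.pi))⁻¹ *
      ((fun x => ∫ u in Set.Ioi x, Real.exp (-(u ^ 2) / 2)) ∘
        fun x => Real.sqrt (x / σ ^ 2)) x := by
    funext x
    rw [hD, hQ, Function.comp_apply]
  rw [hDeq]
  refine h.congr_deriv ?_
  have hexp : -(Real.sqrt (p / σ ^ 2) ^ 2) / 2 = -p / (2 * σ ^ 2) := by
    rw [Real.sq_sqrt hpos.le]
    field_simp
  rw [hexp, Real.sqrt_div hp.le, Real.sqrt_sq hσ.le, Real.rpow_neg hp.le,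
    ← Real.sqrt_eq_rpow]
  have : Real.sqrt p ≠ 0 := (Real.sqrt_pos.2 hp).ne'
  field_simp

/-- For `σ, s, c > 0` and `1/2 < λ ≤ 1`, let `p_f(β)` be the unique positive
solution of `D'(p)·p^(1−λ) = β·λ·c^λ/s^λ` (the maximizer of the subjective utility
`U_f(p) = s^λ·D(p) − β·(c·p)^λ`), where `D(p) = 1 − Q(√(p/σ²))`. Then `p_f` is strictly
decreasing in the loss-aversion coefficient `β`. -/
theorem prospect_optimal_energy_decreasing_in_loss_aversion
    (σ s c lam : ℝ) (hσ : 0 < σ) (hs : 0 < s) (hc : 0 < c)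
    (hlam₁ : 1 / 2 < lam) (hlam₂ : lam ≤ 1)
    (Q D : ℝ → ℝ) (pf : ℝ → ℝ)
    (hQ : ∀ t, Q t = (Real.sqrt (2 * Real.pi))⁻¹ * ∫ u in Set.Ioi t, Real.exp (-(u ^ 2) / 2))
    (hD : ∀ p, D p = 1 - Q (Real.sqrt (p / σ ^ 2)))
    (hpf : ∀ β > (0 : ℝ), 0 < pf β
      ∧ deriv D (pf β) * (pf β) ^ (1 - lam) = β * lam * c ^ lam / s ^ lam) :
    ∀ β₁ β₂ : ℝ, 0 < β₁ → β₁ < β₂ → pf β₁ > pf β₂ := by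
  intro β₁ β₂ h₁ h₁₂
  obtain ⟨hp₁, he₁⟩ := hpf β₁ h₁
  obtain ⟨hp₂, he₂⟩ := hpf β₂ (h₁.trans h₁₂)
  have key : ∀ {p : ℝ}, 0 < p → deriv D p * p ^ (1 - lam) =
      (2 * σ * Real.sqrt (2 * Real.pi))⁻¹ *
        (Real.exp (-p / (2 * σ ^ 2)) * p ^ (1 / 2 - lam)) := by
    intro p hp
    rw [(hasDerivAt_detection hσ hQ hD hp).deriv, mul_assoc, mul_assoc (Real.exp _),
      ← Real.rpow_add hp]
    ring_nf
  rw [key hp₁] at he₁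
  rw [key hp₂] at he₂
  by_contra! hle
  have hmono : Real.exp (-pf β₂ / (2 * σ ^ 2)) * pf β₂ ^ (1 / 2 - lam) ≤
      Real.exp (-pf β₁ / (2 * σ ^ 2)) * pf β₁ ^ (1 / 2 - lam) := by
    gcongr ?_ * ?_
    · gcongr
    · exact Real.rpow_le_rpow_of_nonpos hp₁ hle (by linarith)
  have hrhs : β₁ * lam * c ^ lam / s ^ lam < β₂ * lam * c ^ lam / s ^ lam := by
    have : 0 < lam := by linarith
    gcongr
  rw [← he₁, ← he₂] at hrhs
  exact hrhs.not_ge (by gcongr)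
end

section
/- Let s, c > 0, 0 < t < 1, 0 < λ ≤ 1, β > 0, let p₀ > 0 be the amount of available energy, and let D : ℝ → ℝ be nonnegative and monotonically increasing on [0, p₀]. Define U_w(p) = (s + c·p)^λ · ((1−t)^λ · D(p) − β · t^λ). If (1−t)^λ · D(p₀) − β · t^λ > 0, then U_w(p₀) ≥ U_w(p) for every p ∈ [0, p₀]; that is, the subjective-utility-maximizing human spends all the available energy. -/
/-- Under prospect theory with weighted average reference point, if
`(1−t)^λ·D(p₀) − β·t^λ > 0` then the subjective utility
`U_w(p) = (s + c·p)^λ·((1−t)^λ·D(p) − β·t^λ)` is maximized over `[0, p₀]` at `p₀`: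
the human spends all the available energy. -/
theorem weighted_reference_spend_all_energy
    (s c t lam β p₀ : ℝ) (D Uw : ℝ → ℝ)
    (hs : 0 < s) (hc : 0 < c) (ht₀ : 0 < t) (ht₁ : t < 1)
    (hlam₀ : 0 < lam) (hlam₁ : lam ≤ 1) (hβ : 0 < β) (hp₀ : 0 < p₀)
    (hDnonneg : ∀ p ∈ Set.Icc (0 : ℝ) p₀, 0 ≤ D p)
    (hDmono : MonotoneOn D (Set.Icc (0 : ℝ) p₀))
    (hUw : ∀ p, Uw p = (s + c * p) ^ lam * ((1 - t) ^ lam * D p - β * t ^ lam))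
    (hpos : (1 - t) ^ lam * D p₀ - β * t ^ lam > 0) :
    ∀ p ∈ Set.Icc (0 : ℝ) p₀, Uw p ≤ Uw p₀ := by
  rintro p ⟨hp, hpp₀⟩
  rw [hUw, hUw]
  have hbase : 0 ≤ s + c * p := by positivity
  have hpow : (s + c * p) ^ lam ≤ (s + c * p₀) ^ lam :=
    Real.rpow_le_rpow hbase (by gcongr) hlam₀.le
  have hD : D p ≤ D p₀ := hDmono ⟨hp, hpp₀⟩ ⟨hp₀.le, le_rfl⟩ hpp₀
  have ht : 0 ≤ (1 - t) ^ lam := Real.rpow_nonneg (sub_nonneg.2 ht₁.le) lam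
  have hfactor : (1 - t) ^ lam * D p - β * t ^ lam ≤ (1 - t) ^ lam * D p₀ - β * t ^ lam :=
    sub_le_sub_right (mul_le_mul_of_nonneg_left hD ht) _
  exact (mul_le_mul_of_nonneg_left hfactor (Real.rpow_nonneg hbase lam)).trans
    (mul_le_mul_of_nonneg_right hpow hpos.le)
end

section
/- Let s, c > 0, 0 < t < 1, 0 < λ ≤ 1, let p₀ > 0 be the available energy, and let D : ℝ → ℝ be nonnegative and monotonically increasing on [0, p₀] with D(p₀) > 0. Define the threshold β^s = (1−t)^λ · D(p₀) / t^λ and U_w(p) = (s + c·p)^λ · ((1−t)^λ·D(p) − β·t^λ). Then for every loss-aversion coefficient β with 0 < β < β^s, U_w(p₀) > 0 and U_w(p₀) ≥ U_w(p) for all p ∈ [0, p₀], while for every β ≥ β^s, U_w(p) ≤ 0 for all p ∈ [0, p₀]. Thus a human with β < β^s spends all the available energy and a human with β ≥ β^s spends nothing. -/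
/-- With the threshold `βˢ = (1−t)^λ·D(p₀)/t^λ` and subjective utility
`U_w(β, p) = (s + c·p)^λ·((1−t)^λ·D(p) − β·t^λ)`: every human with loss-aversion
coefficient `0 < β < βˢ` gets positive utility at `p₀` and maximizes utility over
`[0, p₀]` by spending all the available energy, while every human with `β ≥ βˢ` has
non-positive utility throughout `[0, p₀]` and so spends nothing. -/
theorem weighted_reference_loss_aversion_threshold
    (s c t lam p₀ : ℝ) (D : ℝ → ℝ) (Uw : ℝ → ℝ → ℝ)
    (hs : 0 < s) (hc : 0 < c) (ht₀ : 0 < t) (ht₁ : t < 1)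
    (hlam₀ : 0 < lam) (hlam₁ : lam ≤ 1) (hp₀ : 0 < p₀)
    (hDnonneg : ∀ p ∈ Set.Icc (0 : ℝ) p₀, 0 ≤ D p)
    (hDmono : MonotoneOn D (Set.Icc (0 : ℝ) p₀))
    (hDp₀ : 0 < D p₀)
    (hUw : ∀ β p, Uw β p = (s + c * p) ^ lam * ((1 - t) ^ lam * D p - β * t ^ lam)) :
    (∀ β : ℝ, 0 < β → β < (1 - t) ^ lam * D p₀ / t ^ lam →
        0 < Uw β p₀ ∧ ∀ p ∈ Set.Icc (0 : ℝ) p₀, Uw β p ≤ Uw β p₀)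
    ∧ (∀ β : ℝ, (1 - t) ^ lam * D p₀ / t ^ lam ≤ β →
        ∀ p ∈ Set.Icc (0 : ℝ) p₀, Uw β p ≤ 0) := by
  have ht : 0 < t ^ lam := Real.rpow_pos_of_pos ht₀ _
  have ht' : 0 < (1 - t) ^ lam := Real.rpow_pos_of_pos (sub_pos.2 ht₁) _
  have hp₀_mem : p₀ ∈ Set.Icc (0 : ℝ) p₀ := Set.right_mem_Icc.2 hp₀.le
  have hbase : ∀ p ∈ Set.Icc (0 : ℝ) p₀, 0 < s + c * p := fun p hp =>
    add_pos_of_pos_of_nonneg hs (mul_nonneg hc.le hp.1)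
  have hD : ∀ p ∈ Set.Icc (0 : ℝ) p₀, (1 - t) ^ lam * D p ≤ (1 - t) ^ lam * D p₀ :=
    fun p hp => mul_le_mul_of_nonneg_left (hDmono hp hp₀_mem hp.2) ht'.le
  refine ⟨fun β _ hβ => ?_, fun β hβ p hp => ?_⟩
  · rw [lt_div_iff₀ ht] at hβ
    have hgain : 0 < (1 - t) ^ lam * D p₀ - β * t ^ lam := sub_pos.2 hβ
    refine ⟨?_, fun p hp => ?_⟩
    · rw [hUw]
      exact mul_pos (Real.rpow_pos_of_pos (hbase p₀ hp₀_mem) _) hgain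
    · rw [hUw, hUw]
      have hpow : (s + c * p) ^ lam ≤ (s + c * p₀) ^ lam :=
        Real.rpow_le_rpow (hbase p hp).le
          (add_le_add_right (mul_le_mul_of_nonneg_left hp.2 hc.le) s) hlam₀.le
      exact (mul_le_mul_of_nonneg_left (sub_le_sub_right (hD p hp) _)
        (Real.rpow_nonneg (hbase p hp).le _)).trans
        (mul_le_mul_of_nonneg_right hpow hgain.le)
  · rw [div_le_iff₀ ht] at hβ
    rw [hUw]
    exact mul_nonpos_of_nonneg_of_nonpos (Real.rpow_nonneg (hbase p hp).le _)
      (sub_nonpos.2 ((hD p hp).trans hβ))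
end
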